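/- Let A be an integer (r,s)×t bimatrix, let x be a feasible point of the n-fold integer program with objective w and finite bounds l, u, and let γ be a positive integer. Then there exists g = (g¹,…,gⁿ) ∈ ℤ^{nt} such that: every brick gⁱ lies in Z(A); every partial sum Σ_{j≤i} gʲ (for i = 1,…,n) lies in Z(A); A₁·(Σ_{i=1}^n gⁱ) = 0; x + γg is feasible; w·(x+γg) ≤ w·x; and w·(x+γg) ≤ w·(x+γḡ) for every ḡ ∈ 𝒢(A⁽ⁿ⁾) with l ≤ x + γḡ ≤ u. -/

import Mathlib

open Matrix

/-- The conformal (sign-compatible) partial order `x ⊑ y` on integer vectors: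
`x k * y k ≥ 0` and `|x k| ≤ |y k|` for every coordinate `k`. -/
def ConformalLe {ν : Type*} (x y : ν → ℤ) : Prop :=
  ∀ k, 0 ≤ x k * y k ∧ |x k| ≤ |y k|

/-- The Graver basis of an integer matrix `A`: the set of `⊑`-minimal elements of
`{x : A x = 0, x ≠ 0}`. -/
def GraverBasis {μ ν : Type*} [Fintype ν] (A : Matrix μ ν ℤ) : Set (ν → ℤ) :=
  {x | A.mulVec x = 0 ∧ x ≠ 0 ∧
    ∀ y, A.mulVec y = 0 → y ≠ 0 → ConformalLe y x → y = x}

/-- The `ι`-fold product of the bimatrix with blocks `A1` (first block, `r × τ`) and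
`A2` (second block, `s × τ`): the first `r` rows are `(A1 A1 ⋯ A1)` and the remaining
rows form a block-diagonal matrix with a copy of `A2` for each index in `ι`. -/
def nFold {r s : ℕ} {τ : Type*} (A1 : Matrix (Fin r) τ ℤ) (A2 : Matrix (Fin s) τ ℤ)
    (ι : Type*) [DecidableEq ι] : Matrix (Fin r ⊕ ι × Fin s) (ι × τ) ℤ :=
  Matrix.of fun i jt =>
    match i with
    | Sum.inl a => A1 a jt.2
    | Sum.inr (k, c) => if jt.1 = k then A2 c jt.2 else 0

/-- The `i`-th brick of a vector indexed by `ι × τ`. -/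
def brick {ι τ : Type*} (x : ι × τ → ℤ) (i : ι) : τ → ℤ := fun j => x (i, j)

/-- The Graver complexity of the bimatrix `(A1, A2)`: the largest number of nonzero
bricks appearing in any element of the Graver basis of any `n`-fold product. -/
noncomputable def graverComplexity {r s t : ℕ} (A1 : Matrix (Fin r) (Fin t) ℤ)
    (A2 : Matrix (Fin s) (Fin t) ℤ) : ℕ :=
  sSup {k : ℕ | ∃ (n : ℕ) (g : Fin n × Fin t → ℤ),
    g ∈ GraverBasis (nFold A1 A2 (Fin n)) ∧
    k = {i : Fin n | brick g i ≠ 0}.ncard}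

/-- `Z(A)`: the set of all vectors in `ℤ^t` that are sums of at most `g(A)` elements
of the Graver basis of `A2`. -/
noncomputable def ZSet {r s t : ℕ} (A1 : Matrix (Fin r) (Fin t) ℤ)
    (A2 : Matrix (Fin s) (Fin t) ℤ) : Set (Fin t → ℤ) :=
  {z | ∃ L : List (Fin t → ℤ), L.length ≤ graverComplexity A1 A2 ∧
    (∀ h ∈ L, h ∈ GraverBasis A2) ∧ z = L.sum}

theorem conformalLe_iff {ν : Type*} {x y : ν → ℤ} :
    ConformalLe x y ↔ ∀ k, (0 ≤ x k ∧ x k ≤ y k) ∨ (y k ≤ x k ∧ x k ≤ 0) := by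
  refine forall_congr' fun k => ?_
  constructor
  · rintro ⟨h1, h2⟩
    rcases le_total 0 (x k) with hx | hx <;> rcases le_total 0 (y k) with hy | hy
    · left; rw [abs_of_nonneg hx, abs_of_nonneg hy] at h2; exact ⟨hx, h2⟩
    · have h3 : x k * y k = 0 := le_antisymm (mul_nonpos_of_nonneg_of_nonpos hx hy) h1
      rcases mul_eq_zero.1 h3 with h | h
      · right; omega
      · rw [h] at h2; simp at h2; right; omega
    · have h3 : x k * y k = 0 := le_antisymm (mul_nonpos_of_nonpos_of_nonneg hx hy) h1
      rcases mul_eq_zero.1 h3 with h | h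
      · left; omega
      · rw [h] at h2; simp at h2; left; omega
    · right; rw [abs_of_nonpos hx, abs_of_nonpos hy] at h2; omega
  · rintro (⟨h1, h2⟩ | ⟨h1, h2⟩)
    · exact ⟨mul_nonneg h1 (h1.trans h2), abs_le_abs_of_nonneg h1 h2⟩
    · exact ⟨mul_nonneg_of_nonpos_of_nonpos h2 (h1.trans h2), abs_le_abs_of_nonpos h2 h1⟩

theorem ConformalLe.refl {ν : Type*} (x : ν → ℤ) : ConformalLe x x :=
  fun _ => ⟨mul_self_nonneg _, le_rfl⟩

theorem ConformalLe.zero {ν : Type*} (x : ν → ℤ) : ConformalLe 0 x :=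
  fun _ => by simp

theorem ConformalLe.trans {ν : Type*} {x y z : ν → ℤ} (h1 : ConformalLe x y)
    (h2 : ConformalLe y z) : ConformalLe x z := by
  rw [conformalLe_iff] at *
  intro k
  have := h1 k
  have := h2 k
  omega

theorem ConformalLe.sub {ν : Type*} {x y : ν → ℤ} (h : ConformalLe x y) :
    ConformalLe (y - x) y := by
  rw [conformalLe_iff] at *
  intro k
  have := h k
  simp only [Pi.sub_apply]
  omega

/-- If every `h i` is conformal to a common vector `G`, then conformality `y i ⊑ h i`
is preserved by summation. -/
theorem ConformalLe.sum {ι ν : Type*} {S : Finset ι} {y h : ι → ν → ℤ} {G : ν → ℤ}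
    (hy : ∀ i ∈ S, ConformalLe (y i) (h i)) (hh : ∀ i ∈ S, ConformalLe (h i) G) :
    ConformalLe (∑ i ∈ S, y i) (∑ i ∈ S, h i) := by
  simp only [conformalLe_iff] at *
  intro k
  simp only [Finset.sum_apply]
  rcases le_total 0 (G k) with hG | hG
  · left
    refine ⟨Finset.sum_nonneg fun i hi => ?_, Finset.sum_le_sum fun i hi => ?_⟩ <;>
    · have := hy i hi k
      have := hh i hi k
      omega
  · right
    refine ⟨Finset.sum_le_sum fun i hi => ?_, Finset.sum_nonpos fun i hi => ?_⟩ <;>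
    · have := hy i hi k
      have := hh i hi k
      omega

theorem ConformalLe.eq_of_sum_eq {ι ν : Type*} {S : Finset ι} {y h : ι → ν → ℤ} {G : ν → ℤ}
    (hy : ∀ i ∈ S, ConformalLe (y i) (h i)) (hh : ∀ i ∈ S, ConformalLe (h i) G)
    (heq : ∑ i ∈ S, y i = ∑ i ∈ S, h i) : ∀ i ∈ S, y i = h i := by
  simp only [conformalLe_iff] at *
  intro i hi
  funext k
  have hk := congrFun heq k
  simp only [Finset.sum_apply] at hk
  rcases le_total 0 (G k) with hG | hG
  · refine (Finset.sum_eq_sum_iff_of_le fun j hj => ?_).1 hk i hi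
    have := hy j hj k
    have := hh j hj k
    omega
  · refine ((Finset.sum_eq_sum_iff_of_le fun j hj => ?_).1 hk.symm i hi).symm
    have := hy j hj k
    have := hh j hj k
    omega

theorem ConformalLe.sum_abs_lt {ν : Type*} [Fintype ν] {x y : ν → ℤ} (h : ConformalLe x y)
    (hne : x ≠ y) : ∑ k, (x k).natAbs < ∑ k, (y k).natAbs := by
  rw [conformalLe_iff] at h
  obtain ⟨k, hk⟩ := Function.ne_iff.1 hne
  refine Finset.sum_lt_sum (fun j _ => ?_) ⟨k, Finset.mem_univ _, ?_⟩
  · have := h j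
    omega
  · have := h k
    omega

/-- The Graver basis of an integer matrix is finite. -/
theorem graverBasis_finite {μ ν : Type*} [Fintype ν] (A : Matrix μ ν ℤ) :
    (GraverBasis A).Finite := by
  let F : (ν → ℤ) → (ν → ℕ × ℕ) := fun x k => ((x k).toNat, (-x k).toNat)
  have hF : ∀ x y, F x ≤ F y → ConformalLe x y := by
    intro x y hxy
    rw [conformalLe_iff]
    intro k
    have h1 := (hxy k).1
    have h2 := (hxy k).2
    simp only [F] at h1 h2
    omega
  have hinj : Function.Injective F := by
    intro x y hxy
    funext k
    have h1 := congrArg Prod.fst (congrFun hxy k)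
    have h2 := congrArg Prod.snd (congrFun hxy k)
    simp only [F] at h1 h2
    omega
  have hanti : IsAntichain (· ≤ ·) (F '' GraverBasis A) := by
    rintro _ ⟨x, hx, rfl⟩ _ ⟨y, hy, rfl⟩ hne hle
    exact hne (congrArg F (hy.2.2 x hx.1 hx.2.1 (hF x y hle)))
  have hfin : (F '' GraverBasis A).Finite := by
    have : (F '' GraverBasis A).IsPWO := Set.isPWO_of_wellQuasiOrderedLE _
    exact hanti.finite_of_partiallyWellOrderedOn this
  exact Set.Finite.of_finite_image hfin hinj.injOn

/-- Below every nonzero kernel vector there is a Graver basis element. -/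
theorem exists_graverBasis_conformalLe {μ ν : Type*} [Fintype ν] (A : Matrix μ ν ℤ)
    (x : ν → ℤ) (hx : A.mulVec x = 0) (hx0 : x ≠ 0) :
    ∃ y ∈ GraverBasis A, ConformalLe y x := by
  induction hN : ∑ k, (x k).natAbs using Nat.strong_induction_on generalizing x with
  | _ N ih =>
    by_cases hG : x ∈ GraverBasis A
    · exact ⟨x, hG, .refl x⟩
    · have : ∃ y, A.mulVec y = 0 ∧ y ≠ 0 ∧ ConformalLe y x ∧ y ≠ x := by
        by_contra! hcon
        exact hG ⟨hx, hx0, hcon⟩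
      obtain ⟨y, hy, hy0, hyx, hne⟩ := this
      obtain ⟨z, hz, hzy⟩ := ih _ (hN ▸ hyx.sum_abs_lt hne) y hy hy0 rfl
      exact ⟨z, hz, hzy.trans hyx⟩

/-- Every kernel vector is a conformal sum of Graver basis elements. -/
theorem exists_conformal_decomposition {μ ν : Type*} [Fintype ν] (A : Matrix μ ν ℤ)
    (x : ν → ℤ) (hx : A.mulVec x = 0) :
    ∃ L : List (ν → ℤ), (∀ h ∈ L, h ∈ GraverBasis A ∧ ConformalLe h x) ∧ L.sum = x := by
  induction hN : ∑ k, (x k).natAbs using Nat.strong_induction_on generalizing x with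
  | _ N ih =>
    by_cases hx0 : x = 0
    · exact ⟨[], by simp, by simp [hx0]⟩
    · obtain ⟨y, hy, hyx⟩ := exists_graverBasis_conformalLe A x hx hx0
      have hne : x - y ≠ x := fun h => hy.2.1 (by simpa using h)
      obtain ⟨L, hL, hsum⟩ := ih _ (hN ▸ hyx.sub.sum_abs_lt hne) (x - y)
        (by rw [Matrix.mulVec_sub, hx, hy.1, sub_zero]) rfl
      refine ⟨y :: L, ?_, by simp [hsum]⟩
      intro h hh
      rcases List.mem_cons.1 hh with rfl | hh
      · exact ⟨hy, hyx⟩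
      · exact ⟨(hL h hh).1, (hL h hh).2.trans hyx.sub⟩

theorem nFold_mulVec_eq_zero_iff {r s : ℕ} {τ ι : Type*} [Fintype τ] [Fintype ι]
    [DecidableEq ι] (A1 : Matrix (Fin r) τ ℤ) (A2 : Matrix (Fin s) τ ℤ) (g : ι × τ → ℤ) :
    (nFold A1 A2 ι).mulVec g = 0 ↔
      A1.mulVec (∑ i, brick g i) = 0 ∧ ∀ i, A2.mulVec (brick g i) = 0 := by
  have h1 : ∀ a, (nFold A1 A2 ι).mulVec g (Sum.inl a) = A1.mulVec (∑ i, brick g i) a := by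
    intro a
    rw [Matrix.mulVec_sum, Finset.sum_apply]
    simp [Matrix.mulVec, dotProduct, nFold, Fintype.sum_prod_type, brick]
  have h2 : ∀ i c, (nFold A1 A2 ι).mulVec g (Sum.inr (i, c)) = A2.mulVec (brick g i) c := by
    intro i c
    simp only [Matrix.mulVec, dotProduct, nFold, Fintype.sum_prod_type, brick, Matrix.of_apply,
      ite_mul, zero_mul]
    rw [Finset.sum_eq_single i] <;> simp +contextual
  constructor
  · intro h
    refine ⟨funext fun a => ?_, fun i => funext fun c => ?_⟩
    · rw [← h1, h]; rfl
    · rw [← h2, h]; rfl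
  · rintro ⟨ha, hc⟩
    funext i
    rcases i with a | ⟨i, c⟩
    · rw [h1, ha]; rfl
    · rw [h2, hc]; rfl

theorem ext_brick {ι τ : Type*} {g h : ι × τ → ℤ} (H : ∀ i, brick g i = brick h i) : g = h := by
  funext ⟨i, j⟩
  exact congrFun (H i) j

theorem conformalLe_iff_brick {ι τ : Type*} {g h : ι × τ → ℤ} :
    ConformalLe g h ↔ ∀ i, ConformalLe (brick g i) (brick h i) :=
  Prod.forall

/-- Splitting the bricks of a Graver basis element conformally into kernel vectors of
`A2` produces a Graver basis element of a larger `n`-fold product. -/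
theorem mem_graverBasis_nFold_of_split {r s : ℕ} {τ ι κ : Type*} [Fintype τ] [Fintype ι]
    [DecidableEq ι] [Fintype κ] [DecidableEq κ] {A1 : Matrix (Fin r) τ ℤ}
    {A2 : Matrix (Fin s) τ ℤ} {g : κ × τ → ℤ} (hg : g ∈ GraverBasis (nFold A1 A2 κ))
    (f : ι → κ) (h : ι × τ → ℤ) (hker : ∀ i, A2.mulVec (brick h i) = 0)
    (hle : ∀ i, ConformalLe (brick h i) (brick g (f i)))
    (hsum : ∀ k, ∑ i with f i = k, brick h i = brick g k) :
    h ∈ GraverBasis (nFold A1 A2 ι) := by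
  obtain ⟨hg1, hg2, hg3⟩ := hg
  rw [nFold_mulVec_eq_zero_iff] at hg1
  have hle' : ∀ k, ∀ i ∈ Finset.univ.filter (fun i => f i = k),
      ConformalLe (brick h i) (brick g k) := by
    intro k i hi
    have : f i = k := by simpa using hi
    exact this ▸ hle i
  refine ⟨?_, ?_, ?_⟩
  · rw [nFold_mulVec_eq_zero_iff]
    refine ⟨?_, hker⟩
    rw [← Finset.sum_fiberwise (s := Finset.univ) (g := f)]
    simp only [hsum]
    exact hg1.1
  · rintro rfl
    refine hg2 (ext_brick fun k => ?_)
    rw [← hsum k]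
    exact Finset.sum_eq_zero fun i _ => rfl
  · intro y hy hy0 hyh
    rw [nFold_mulVec_eq_zero_iff] at hy
    rw [conformalLe_iff_brick] at hyh
    have hyk : ∀ k, ∀ i ∈ Finset.univ.filter (fun i => f i = k),
        ConformalLe (brick y i) (brick g k) := fun k i hi => (hyh i).trans (hle' k i hi)
    let Y : κ × τ → ℤ := fun p => (∑ i with f i = p.1, brick y i) p.2
    have hY : ∀ k, brick Y k = ∑ i with f i = k, brick y i := fun k => rfl
    have hYg : Y = g := by
      refine hg3 Y ?_ ?_ ?_
      · rw [nFold_mulVec_eq_zero_iff]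
        refine ⟨?_, fun k => ?_⟩
        · simp only [hY]
          rw [Finset.sum_fiberwise]
          exact hy.1
        · rw [hY, Matrix.mulVec_sum]
          exact Finset.sum_eq_zero fun i _ => hy.2 i
      · intro hY0
        refine hy0 (ext_brick fun i => ?_)
        have := ConformalLe.eq_of_sum_eq (S := Finset.univ.filter (fun j => f j = f i))
          (y := fun _ => 0) (h := brick y) (G := brick g (f i)) (fun j _ => .zero _)
          (hyk _) (by rw [← hY, hY0]; simp; rfl) i (by simp)
        exact this.symm
      · rw [conformalLe_iff_brick]
        intro k
        rw [hY, ← hsum]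
        exact ConformalLe.sum (fun i _ => hyh i) (hle' k)
    refine ext_brick fun i => ?_
    refine ConformalLe.eq_of_sum_eq (S := Finset.univ.filter (fun j => f j = f i))
      (fun j _ => hyh j) (hle' (f i)) ?_ i (by simp)
    rw [hsum, ← hY, hYg]

/-- The number of bricks of a Graver basis element all of whose bricks belong to the Graver
basis of `A2` is bounded. -/
theorem exists_bound_of_bricks_mem_graverBasis {r s t : ℕ} (A1 : Matrix (Fin r) (Fin t) ℤ)
    (A2 : Matrix (Fin s) (Fin t) ℤ) :
    ∃ N : ℕ, ∀ (m : ℕ) (h : Fin m × Fin t → ℤ), h ∈ GraverBasis (nFold A1 A2 (Fin m)) →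
      (∀ i, brick h i ∈ GraverBasis A2) → m ≤ N := by
  classical
  have : Fintype (GraverBasis A2) := (graverBasis_finite A2).fintype
  let S : Set (GraverBasis A2 → ℕ) := {c | ∃ (m : ℕ) (h : Fin m × Fin t → ℤ),
    h ∈ GraverBasis (nFold A1 A2 (Fin m)) ∧ (∀ i, brick h i ∈ GraverBasis A2) ∧
    ∀ v : GraverBasis A2, c v = (Finset.univ.filter fun i => brick h i = v.1).card}
  have hbrick : ∀ {m : ℕ} (h : Fin m × Fin t → ℤ), (∀ i, brick h i ∈ GraverBasis A2) →
      ∑ i, brick h i =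
        ∑ v : GraverBasis A2, (Finset.univ.filter fun i => brick h i = v.1).card • v.1 := by
    intro m h hh
    rw [← Finset.sum_fiberwise (s := Finset.univ)
      (g := fun i => (⟨brick h i, hh i⟩ : GraverBasis A2))]
    refine Finset.sum_congr rfl fun v _ => ?_
    simp only [Subtype.ext_iff]
    rw [Finset.sum_congr rfl (g := fun _ => v.1) (by simp), Finset.sum_const]
  have hanti : IsAntichain (· ≤ ·) S := by
    rintro c ⟨m, h, hG, hh, hc⟩ c' ⟨m', h', hG', hh', hc'⟩ hne hle
    have hex : ∀ v : GraverBasis A2,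
        ∃ T ⊆ Finset.univ.filter (fun i => brick h' i = v.1), T.card = c v :=
      fun v => Finset.exists_subset_card_eq (hc' v ▸ hle v)
    choose T hT hTc using hex
    let y : Fin m' × Fin t → ℤ :=
      fun p => if p.1 ∈ T ⟨brick h' p.1, hh' p.1⟩ then h' p else 0
    have hy : ∀ i, brick y i = if i ∈ T ⟨brick h' i, hh' i⟩ then brick h' i else 0 := by
      intro i
      funext j
      simp only [brick, y]
      split_ifs <;> rfl
    have hmem : ∀ v i, i ∈ T v ↔ (brick h' i = v.1 ∧ i ∈ T ⟨brick h' i, hh' i⟩) := by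
      intro v i
      constructor
      · intro hi
        have h1 : brick h' i = v.1 := by simpa using hT v hi
        refine ⟨h1, ?_⟩
        have : (⟨brick h' i, hh' i⟩ : GraverBasis A2) = v := Subtype.ext h1
        rwa [this]
      · rintro ⟨h1, h2⟩
        have : (⟨brick h' i, hh' i⟩ : GraverBasis A2) = v := Subtype.ext h1
        rwa [this] at h2
    have hsum : ∑ i, brick y i = ∑ i, brick h i := by
      rw [hbrick h hh, ← Finset.sum_fiberwise (s := Finset.univ)
        (g := fun i => (⟨brick h' i, hh' i⟩ : GraverBasis A2))]
      refine Finset.sum_congr rfl fun v _ => ?_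
      rw [← hc v, ← hTc v, ← Finset.sum_const]
      have hTv : T v = Finset.univ.filter
          (fun i => brick h' i = v.1 ∧ i ∈ T ⟨brick h' i, hh' i⟩) := by
        ext i
        simpa using hmem v i
      rw [hTv, ← Finset.filter_filter, Finset.sum_filter _ (f := fun _ => v.1)]
      simp only [Subtype.ext_iff]
      refine Finset.sum_congr rfl fun i hi => ?_
      have hi' : brick h' i = v.1 := by simpa using hi
      rw [hy]
      split_ifs
      · exact hi'
      · rfl
    have hk := (nFold_mulVec_eq_zero_iff A1 A2 h).1 hG.1
    have hyh : y = h' := by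
      refine hG'.2.2 y ?_ ?_ ?_
      · rw [nFold_mulVec_eq_zero_iff]
        refine ⟨by rw [hsum]; exact hk.1, fun i => ?_⟩
        rw [hy]
        split_ifs
        · exact (hh' i).1
        · exact Matrix.mulVec_zero _
      · intro hy0
        have hm : 0 < m := by
          rcases Nat.eq_zero_or_pos m with rfl | hm
          · exact absurd (ext_brick fun i => i.elim0) hG.2.1
          · exact hm
        have hTe : ∀ v, T v = ∅ := by
          intro v
          refine Finset.eq_empty_of_forall_notMem fun i hi => ?_
          have h1 := hy i
          rw [if_pos ((hmem v i).1 hi).2, hy0] at h1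
          exact (hh' i).2.1 h1.symm
        have h0 := hTc ⟨brick h ⟨0, hm⟩, hh _⟩
        rw [hTe, hc, Finset.card_empty, eq_comm, Finset.card_eq_zero] at h0
        exact Finset.notMem_empty (⟨0, hm⟩ : Fin m) (h0 ▸ by simp)
      · rw [conformalLe_iff_brick]
        intro i
        rw [hy]
        split_ifs
        · exact .refl _
        · exact .zero _
    refine hne (funext fun v => ?_)
    rw [hc' v, ← hTc v]
    congr 1
    refine (hT v).antisymm fun i hi => ?_
    rw [hmem]
    refine ⟨by simpa using hi, ?_⟩
    by_contra hcon
    have h1 := hy i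
    rw [if_neg hcon, hyh] at h1
    exact (hh' i).2.1 h1
  have hfin : S.Finite :=
    hanti.finite_of_partiallyWellOrderedOn (Set.isPWO_of_wellQuasiOrderedLE S)
  obtain ⟨N, hN⟩ := (hfin.image fun c => ∑ v, c v).bddAbove
  refine ⟨N, fun m h hG hh => ?_⟩
  have := hN ⟨fun v => (Finset.univ.filter fun i => brick h i = v.1).card,
    ⟨m, h, hG, hh, fun _ => rfl⟩, rfl⟩
  refine le_trans (le_of_eq ?_) this
  have hcard := Finset.card_eq_sum_card_fiberwise (s := (Finset.univ : Finset (Fin m)))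
    (t := Finset.univ) (f := fun i => (⟨brick h i, hh i⟩ : GraverBasis A2)) (by simp)
  simpa [Subtype.ext_iff] using hcard

/-- Every Graver basis element of an `n`-fold product splits brickwise into Graver basis
elements of `A2`, which together form a Graver basis element of a larger product. -/
theorem exists_brick_decomposition {r s t n : ℕ} {A1 : Matrix (Fin r) (Fin t) ℤ}
    {A2 : Matrix (Fin s) (Fin t) ℤ} {g : Fin n × Fin t → ℤ}
    (hg : g ∈ GraverBasis (nFold A1 A2 (Fin n))) :
    ∃ L : Fin n → List (Fin t → ℤ), (∀ i, ∀ h ∈ L i, h ∈ GraverBasis A2) ∧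
      (∀ i, (L i).sum = brick g i) ∧
      ∃ h : Fin (∑ i, (L i).length) × Fin t → ℤ,
        h ∈ GraverBasis (nFold A1 A2 (Fin (∑ i, (L i).length))) ∧
        ∀ i, brick h i ∈ GraverBasis A2 := by
  have hker := (nFold_mulVec_eq_zero_iff A1 A2 g).1 hg.1
  choose L hL hsum using fun i => exists_conformal_decomposition A2 (brick g i) (hker.2 i)
  refine ⟨L, fun i h hh => (hL i h hh).1, hsum, ?_⟩
  let e : Fin (∑ i, (L i).length) ≃ (Σ i, Fin (L i).length) := finSigmaFinEquiv.symm
  let H : (Σ i, Fin (L i).length) → Fin t → ℤ := fun p => (L p.1).get p.2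
  let h : Fin (∑ i, (L i).length) × Fin t → ℤ := fun p => H (e p.1) p.2
  have hb : ∀ p, brick h p = H (e p) := fun p => rfl
  have hH : ∀ p, H p ∈ L p.1 := fun p => List.get_mem _ _
  refine ⟨h, mem_graverBasis_nFold_of_split hg (fun p => (e p).1) h ?_ ?_ ?_, ?_⟩
  · intro p
    exact (hL _ _ (hH (e p))).1.1
  · intro p
    exact (hL _ _ (hH (e p))).2
  · intro k
    rw [← hsum k, Finset.sum_filter]
    simp only [hb]
    rw [e.sum_comp (fun p => if p.1 = k then H p else 0), Fintype.sum_sigma,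
      Finset.sum_eq_single k]
    · simp [H, Fin.sum_univ_getElem]
    · intro i _ hi
      simp [hi]
    · simp
  · intro p
    exact (hL _ _ (hH (e p))).1

theorem bddAbove_graverComplexity {r s t : ℕ} (A1 : Matrix (Fin r) (Fin t) ℤ)
    (A2 : Matrix (Fin s) (Fin t) ℤ) :
    BddAbove {k : ℕ | ∃ (n : ℕ) (g : Fin n × Fin t → ℤ),
      g ∈ GraverBasis (nFold A1 A2 (Fin n)) ∧ k = {i : Fin n | brick g i ≠ 0}.ncard} := by
  classical
  obtain ⟨N, hN⟩ := exists_bound_of_bricks_mem_graverBasis A1 A2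
  refine ⟨N, ?_⟩
  rintro _ ⟨n, g, hg, rfl⟩
  obtain ⟨L, -, hsum, h, hh, hhb⟩ := exists_brick_decomposition hg
  refine le_trans ?_ (hN _ h hh hhb)
  rw [Set.ncard_eq_toFinset_card', Finset.card_eq_sum_ones]
  refine le_trans (Finset.sum_le_sum (g := fun i => (L i).length) fun i hi => ?_)
    (Finset.sum_le_sum_of_subset (Finset.subset_univ _))
  have hi' : brick g i ≠ 0 := by simpa using hi
  refine List.length_pos_of_ne_nil fun h0 => hi' ?_
  rw [← hsum i, h0, List.sum_nil]

/-- Any sum of distinct bricks of a Graver basis element of an `n`-fold product lies in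
`Z(A)`. -/
theorem sum_brick_mem_ZSet {r s t n : ℕ} {A1 : Matrix (Fin r) (Fin t) ℤ}
    {A2 : Matrix (Fin s) (Fin t) ℤ} {g : Fin n × Fin t → ℤ}
    (hg : g ∈ GraverBasis (nFold A1 A2 (Fin n))) (S : Finset (Fin n)) :
    ∑ i ∈ S, brick g i ∈ ZSet A1 A2 := by
  obtain ⟨L, hL, hsum, h, hh, hhb⟩ := exists_brick_decomposition hg
  have hm : ∑ i, (L i).length ≤ graverComplexity A1 A2 := by
    refine le_csSup (bddAbove_graverComplexity A1 A2) ⟨_, h, hh, ?_⟩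
    have : {i | brick h i ≠ 0} = Set.univ := Set.eq_univ_of_forall fun i => (hhb i).2.1
    rw [this, Set.ncard_univ, Nat.card_fin]
  refine ⟨S.toList.flatMap L, ?_, ?_, ?_⟩
  · rw [List.length_flatMap, Finset.sum_map_toList]
    exact (Finset.sum_le_sum_of_subset (Finset.subset_univ _)).trans hm
  · intro v hv
    obtain ⟨i, -, hi⟩ := List.mem_flatMap.1 hv
    exact hL i v hi
  · rw [List.flatMap_def, List.sum_flatten, List.map_map, Finset.sum_map_toList]
    exact Finset.sum_congr rfl fun i _ => (hsum i).symm

theorem zero_mem_ZSet {r s t : ℕ} (A1 : Matrix (Fin r) (Fin t) ℤ)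
    (A2 : Matrix (Fin s) (Fin t) ℤ) : (0 : Fin t → ℤ) ∈ ZSet A1 A2 :=
  ⟨[], by simp, by simp, by simp⟩

/-- Given a feasible point `x` of the `n`-fold integer program and a
positive integer `γ`, there is a vector `g` all of whose bricks and partial brick sums
lie in `Z(A)`, with `A₁ (∑ᵢ gⁱ) = 0`, such that `x + γ g` is feasible, not worse than
`x`, and at least as good as `x + γ ḡ` for every `ḡ ∈ 𝒢(A⁽ⁿ⁾)` with `x + γ ḡ` within
the bounds. -/
theorem exists_good_step_for_fixed_stepsize {r s t n : ℕ}
    (A1 : Matrix (Fin r) (Fin t) ℤ) (A2 : Matrix (Fin s) (Fin t) ℤ)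
    (w l u : Fin n × Fin t → ℤ) (b : Fin r ⊕ Fin n × Fin s → ℤ)
    (x : Fin n × Fin t → ℤ)
    (hxb : (nFold A1 A2 (Fin n)).mulVec x = b) (hxl : l ≤ x) (hxu : x ≤ u)
    (γ : ℕ) (hγ : 0 < γ) :
    ∃ g : Fin n × Fin t → ℤ,
      (∀ i, brick g i ∈ ZSet A1 A2) ∧
      (∀ i : Fin n, (fun j => ∑ i' ∈ Finset.univ.filter (· ≤ i), g (i', j))
          ∈ ZSet A1 A2) ∧
      A1.mulVec (fun j => ∑ i, brick g i j) = 0 ∧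
      (nFold A1 A2 (Fin n)).mulVec (x + (γ : ℤ) • g) = b ∧
      l ≤ x + (γ : ℤ) • g ∧ x + (γ : ℤ) • g ≤ u ∧
      w ⬝ᵥ (x + (γ : ℤ) • g) ≤ w ⬝ᵥ x ∧
      ∀ gbar ∈ GraverBasis (nFold A1 A2 (Fin n)),
        l ≤ x + (γ : ℤ) • gbar → x + (γ : ℤ) • gbar ≤ u →
        w ⬝ᵥ (x + (γ : ℤ) • g) ≤ w ⬝ᵥ (x + (γ : ℤ) • gbar) := by
  have hfin : {g | (g = 0 ∨ g ∈ GraverBasis (nFold A1 A2 (Fin n))) ∧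
      l ≤ x + (γ : ℤ) • g ∧ x + (γ : ℤ) • g ≤ u}.Finite :=
    ((graverBasis_finite (nFold A1 A2 (Fin n))).insert 0).subset fun g hg => hg.1
  obtain ⟨g, ⟨hg, hgl, hgu⟩, hmin⟩ := Set.exists_min_image _
    (fun g => w ⬝ᵥ (x + (γ : ℤ) • g)) hfin ⟨0, Or.inl rfl, by simpa using hxl, by simpa using hxu⟩
  have hZ : ∀ S : Finset (Fin n), ∑ i ∈ S, brick g i ∈ ZSet A1 A2 := by
    intro S
    rcases hg with rfl | hg
    · have h0 : ∑ i ∈ S, brick (0 : Fin n × Fin t → ℤ) i = 0 :=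
        Finset.sum_eq_zero fun i _ => rfl
      exact h0 ▸ zero_mem_ZSet A1 A2
    · exact sum_brick_mem_ZSet hg S
  have hker : (nFold A1 A2 (Fin n)).mulVec g = 0 := by
    rcases hg with rfl | hg
    · exact Matrix.mulVec_zero _
    · exact hg.1
  refine ⟨g, fun i => by simpa using hZ {i}, fun i => ?_, ?_, ?_, hgl, hgu, ?_, ?_⟩
  · convert hZ (Finset.univ.filter (· ≤ i)) using 1
    funext j
    simp [brick]
  · convert ((nFold_mulVec_eq_zero_iff A1 A2 g).1 hker).1 using 2
    funext j
    simp
  · rw [Matrix.mulVec_add, Matrix.mulVec_smul, hker, smul_zero, add_zero, hxb]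
  · simpa using hmin 0 ⟨Or.inl rfl, by simpa using hxl, by simpa using hxu⟩
  · exact fun gbar hG h1 h2 => hmin gbar ⟨Or.inr hG, h1, h2⟩
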